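/- arXiv:math/0408229 — 3 statements merged into one kernel-verified Lean document; each statement's English description precedes it below -/
import Mathlib

section
/- Let m ≥ 1 be an integer, let f and g be smooth functions on a dilation-invariant open set U ⊆ ℝ^N, both homogeneous of degree m − n/2, and suppose f − g = Q·h on U for some smooth h : U → ℝ homogeneous of degree m − 2 − n/2. Then Δ^m f (x) = Δ^m g (x) for every x ∈ U with Q(x) = 0. (Thus in the flat model the operator Δ^m on homogeneous functions of degree m − n/2 descends to a well-defined operator on their restrictions to the null cone {Q = 0}, i.e. the flat GJMS operator is well defined.) -/
noncomputable section

open scoped BigOperators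

/-- The `i`-th partial derivative of a function on `ℝ^N`. -/
def pderiv' {N : ℕ} (i : Fin N) (f : (Fin N → ℝ) → ℝ) : (Fin N → ℝ) → ℝ :=
  fun x => fderiv ℝ f x (Pi.single i 1)

/-- The flat pseudo-Laplacian `Δf = ∑ i, εᵢ ∂²f/∂xᵢ²` with signs `ε`. -/
def lapE {N : ℕ} (ε : Fin N → ℝ) (f : (Fin N → ℝ) → ℝ) : (Fin N → ℝ) → ℝ :=
  fun x => ∑ i, ε i * pderiv' i (pderiv' i f) x

/-- The Euler operator `(Ef)(x) = ∑ i, xᵢ ∂f/∂xᵢ (x)`. -/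
def eulerOp {N : ℕ} (f : (Fin N → ℝ) → ℝ) : (Fin N → ℝ) → ℝ :=
  fun x => ∑ i, x i * pderiv' i f x

/-- The quadratic form `Q(x) = ∑ i, εᵢ xᵢ²`. -/
def Qform {N : ℕ} (ε : Fin N → ℝ) : (Fin N → ℝ) → ℝ :=
  fun x => ∑ i, ε i * (x i) ^ 2

/-- An open set `U ⊆ ℝ^N` is dilation-invariant if `t • x ∈ U` for `x ∈ U`, `t > 0`. -/
def DilationInvariant {N : ℕ} (U : Set (Fin N → ℝ)) : Prop :=
  ∀ x ∈ U, ∀ t : ℝ, 0 < t → t • x ∈ U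

/-- `f` is homogeneous of degree `w` on `U`: `f(t • x) = t^w f(x)` for `x ∈ U`, `t > 0`. -/
def HomogeneousOn {N : ℕ} (f : (Fin N → ℝ) → ℝ) (w : ℝ) (U : Set (Fin N → ℝ)) : Prop :=
  ∀ x ∈ U, ∀ t : ℝ, 0 < t → f (t • x) = t ^ w * f x

theorem aux_smooth {N : ℕ} {U : Set (Fin N → ℝ)} (hU : IsOpen U) {f : (Fin N → ℝ) → ℝ}
    (hf : ContDiffOn ℝ (⊤ : ℕ∞) f U) (i : Fin N) : ContDiffOn ℝ (⊤ : ℕ∞) (pderiv' i f) U := by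
  have h1 : ContDiffOn ℝ (⊤ : ℕ∞) (fderiv ℝ f) U :=
    hf.fderiv_of_isOpen hU (by simp)
  exact h1.clm_apply contDiffOn_const

theorem aux_diff {N : ℕ} {U : Set (Fin N → ℝ)} (hU : IsOpen U) {f : (Fin N → ℝ) → ℝ}
    (hf : ContDiffOn ℝ (⊤ : ℕ∞) f U) {x : Fin N → ℝ} (hx : x ∈ U) : DifferentiableAt ℝ f x :=
  (hf.differentiableOn (by simp)).differentiableAt (hU.mem_nhds hx)

theorem aux_lap_smooth {N : ℕ} {U : Set (Fin N → ℝ)} (hU : IsOpen U) (ε : Fin N → ℝ)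
    {f : (Fin N → ℝ) → ℝ}
    (hf : ContDiffOn ℝ (⊤ : ℕ∞) f U) : ContDiffOn ℝ (⊤ : ℕ∞) (lapE ε f) U := by
  unfold lapE
  exact ContDiffOn.sum fun i _ => contDiffOn_const.mul (aux_smooth hU (aux_smooth hU hf i) i)

theorem aux_congr {N : ℕ} {U : Set (Fin N → ℝ)} (hU : IsOpen U) {f g : (Fin N → ℝ) → ℝ}
    (h : ∀ x ∈ U, f x = g x) (i : Fin N) : ∀ x ∈ U, pderiv' i f x = pderiv' i g x := by
  intro x hx
  have : f =ᶠ[nhds x] g := Filter.eventuallyEq_of_mem (hU.mem_nhds hx) h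
  unfold pderiv'
  rw [this.fderiv_eq]

theorem aux_add {N : ℕ} {f g : (Fin N → ℝ) → ℝ} {x : Fin N → ℝ} (hf : DifferentiableAt ℝ f x)
    (hg : DifferentiableAt ℝ g x) (i : Fin N) :
    pderiv' i (fun y => f y + g y) x = pderiv' i f x + pderiv' i g x := by
  unfold pderiv'
  rw [fderiv_fun_add hf hg]; rfl

theorem aux_mul {N : ℕ} {f g : (Fin N → ℝ) → ℝ} {x : Fin N → ℝ} (hf : DifferentiableAt ℝ f x)
    (hg : DifferentiableAt ℝ g x) (i : Fin N) :
    pderiv' i (fun y => f y * g y) x = f x * pderiv' i g x + pderiv' i f x * g x := by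
  unfold pderiv'
  rw [fderiv_fun_mul hf hg]
  simp [mul_comm]

theorem aux_coord {N : ℕ} (c : ℝ) (i j : Fin N) (x : Fin N → ℝ) :
    pderiv' i (fun y => c * y j) x = if j = i then c else 0 := by
  unfold pderiv'
  have : HasFDerivAt (fun y : Fin N → ℝ => c * y j)
      (c • (ContinuousLinearMap.proj j : (Fin N → ℝ) →L[ℝ] ℝ)) x :=
    ((ContinuousLinearMap.proj j : (Fin N → ℝ) →L[ℝ] ℝ).hasFDerivAt).const_mul c
  rw [this.fderiv]
  simp [Pi.single_apply]

theorem aux_const {N : ℕ} (c : ℝ) (i : Fin N) (x : Fin N → ℝ) :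
    pderiv' i (fun _ => c) x = 0 := by
  simp [pderiv']

theorem aux_Q_smooth {N : ℕ} (ε : Fin N → ℝ) : ContDiff ℝ (⊤ : ℕ∞) (Qform ε) := by
  unfold Qform
  fun_prop

theorem aux_Q {N : ℕ} (ε : Fin N → ℝ) (i : Fin N) (x : Fin N → ℝ) :
    pderiv' i (Qform ε) x = 2 * ε i * x i := by
  have h1 : ∀ j ∈ Finset.univ, HasFDerivAt (fun y : Fin N → ℝ => ε j * (y j) ^ 2)
      (ε j • ((2 * x j) • (ContinuousLinearMap.proj j : (Fin N → ℝ) →L[ℝ] ℝ))) x := by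
    intro j _
    have := (((ContinuousLinearMap.proj j : (Fin N → ℝ) →L[ℝ] ℝ).hasFDerivAt (x := x)).pow 2).const_mul (ε j)
    simpa using this
  have h2 := HasFDerivAt.fun_sum h1
  unfold pderiv' Qform
  rw [h2.fderiv]
  simp [Pi.single_apply]
  ring

theorem aux_hom {N : ℕ} {U : Set (Fin N → ℝ)} (hU : IsOpen U) (hD : DilationInvariant U)
    {f : (Fin N → ℝ) → ℝ} (hf : ContDiffOn ℝ (⊤ : ℕ∞) f U) {w : ℝ} (hw : HomogeneousOn f w U)
    (i : Fin N) : HomogeneousOn (pderiv' i f) (w - 1) U := by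
  intro x hx t ht
  have h1 : (fun y => f (t • y)) =ᶠ[nhds x] fun y => t ^ w * f y :=
    Filter.eventuallyEq_of_mem (hU.mem_nhds hx) fun y hy => hw y hy t ht
  have h2 : fderiv ℝ (fun y => f (t • y)) x = t • fderiv ℝ f (t • x) := by
    have ha := (aux_diff hU hf (hD x hx t ht)).hasFDerivAt
    have hb : HasFDerivAt (fun y : Fin N → ℝ => t • y)
      (t • ContinuousLinearMap.id ℝ (Fin N → ℝ)) x := (hasFDerivAt_id x).const_smul t
    have hc := ha.comp x hb
    rw [show (fun y => f (t • y)) = f ∘ (fun y => t • y) from rfl, hc.fderiv]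
    ext v
    simp
  have h3 := h1.fderiv_eq (𝕜 := ℝ)
  rw [h2, fderiv_const_mul (aux_diff hU hf hx)] at h3
  have h4 := congrArg (fun L : (Fin N → ℝ) →L[ℝ] ℝ => L (Pi.single i (1 : ℝ))) h3
  simp only [ContinuousLinearMap.smul_apply, smul_eq_mul] at h4
  unfold pderiv'
  rw [Real.rpow_sub_one ht.ne']
  field_simp
  linarith

theorem aux_lap_hom {N : ℕ} {U : Set (Fin N → ℝ)} (hU : IsOpen U) (hD : DilationInvariant U)
    (ε : Fin N → ℝ)
    {f : (Fin N → ℝ) → ℝ} (hf : ContDiffOn ℝ (⊤ : ℕ∞) f U) {w : ℝ} (hw : HomogeneousOn f w U) :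
    HomogeneousOn (lapE ε f) (w - 2) U := by
  intro x hx t ht
  unfold lapE
  rw [Finset.mul_sum]
  refine Finset.sum_congr rfl fun i _ => ?_
  rw [aux_hom hU hD (aux_smooth hU hf i) (aux_hom hU hD hf hw i) i x hx t ht,
    show w - 1 - 1 = w - 2 by ring]
  ring

theorem aux_euler {N : ℕ} {U : Set (Fin N → ℝ)} (hU : IsOpen U)
    {f : (Fin N → ℝ) → ℝ} (hf : ContDiffOn ℝ (⊤ : ℕ∞) f U) {w : ℝ} (hw : HomogeneousOn f w U) :
    ∀ x ∈ U, ∑ i, x i * pderiv' i f x = w * f x := by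
  intro x hx
  have h1 : (fun t : ℝ => f (t • x)) =ᶠ[nhds 1] fun t => t ^ w * f x :=
    Filter.eventuallyEq_of_mem (Ioi_mem_nhds (zero_lt_one)) fun t ht => hw x hx t ht
  have h2 : HasDerivAt (fun t : ℝ => t ^ w * f x) (w * f x) 1 := by
    simpa using (Real.hasDerivAt_rpow_const (x := 1) (p := w) (Or.inl one_ne_zero)).mul_const (f x)
  have h3 : HasDerivAt (fun t : ℝ => f (t • x)) (fderiv ℝ f x x) 1 := by
    have ha : HasFDerivAt f (fderiv ℝ f x) ((1 : ℝ) • x) := by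
      rw [one_smul]; exact (aux_diff hU hf hx).hasFDerivAt
    have hb : HasDerivAt (fun t : ℝ => t • x) x 1 := by
      simpa using (hasDerivAt_id (1 : ℝ)).smul_const x
    exact ha.comp_hasDerivAt (1 : ℝ) hb
  rw [(h2.congr_of_eventuallyEq h1).unique h3]
  conv_rhs => enter [2]; rw [pi_eq_sum_univ' x]
  simp only [map_sum, map_smul, smul_eq_mul, pderiv']

theorem aux_step {N : ℕ} {U : Set (Fin N → ℝ)} (hU : IsOpen U) (ε : Fin N → ℝ)
    (hε : ∀ i, ε i = 1 ∨ ε i = -1) {F G H K : (Fin N → ℝ) → ℝ} {c w : ℝ}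
    (hG : ContDiffOn ℝ (⊤ : ℕ∞) G U) (hH : ContDiffOn ℝ (⊤ : ℕ∞) H U)
    (hK : ContDiffOn ℝ (⊤ : ℕ∞) K U) (hw : HomogeneousOn H w U)
    (h : ∀ x ∈ U, F x = G x + Qform ε x * H x + c * K x) :
    ∀ x ∈ U, lapE ε F x = lapE ε G x + Qform ε x * lapE ε H x + (4 * w + 2 * N) * H x
      + c * lapE ε K x := by
  have dQ : ∀ x, DifferentiableAt ℝ (Qform ε) x := fun x =>
    (aux_Q_smooth ε).differentiable (by simp) x
  have h1 : ∀ i, ∀ x ∈ U, pderiv' i F x = pderiv' i G x +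
      (Qform ε x * pderiv' i H x + (2 * ε i * x i) * H x) + c * pderiv' i K x := by
    intro i x hx
    have dG := aux_diff hU hG hx
    have dH := aux_diff hU hH hx
    have dK := aux_diff hU hK hx
    rw [aux_congr hU h i x hx, aux_add (dG.fun_add ((dQ x).fun_mul dH)) (dK.const_mul c),
      aux_add dG ((dQ x).fun_mul dH), aux_mul (dQ x) dH, aux_mul (by fun_prop) dK, aux_Q, aux_const]
    ring
  have h2 : ∀ i, ∀ x ∈ U, pderiv' i (pderiv' i F) x = pderiv' i (pderiv' i G) x +
      (Qform ε x * pderiv' i (pderiv' i H) x + 4 * ε i * (x i * pderiv' i H x) + 2 * ε i * H x)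
       + c * pderiv' i (pderiv' i K) x := by
    intro i x hx
    have dG := aux_diff hU (aux_smooth hU hG i) hx
    have dH := aux_diff hU hH hx
    have dH' := aux_diff hU (aux_smooth hU hH i) hx
    have dK := aux_diff hU (aux_smooth hU hK i) hx
    have dx : DifferentiableAt ℝ (fun y : Fin N → ℝ => 2 * ε i * y i) x := by fun_prop
    have d1 := (dQ x).fun_mul dH'
    have d2 := dx.fun_mul dH
    rw [aux_congr hU (h1 i) i x hx, aux_add (dG.fun_add (d1.fun_add d2)) (dK.const_mul c),
      aux_add dG (d1.fun_add d2), aux_add d1 d2, aux_mul (dQ x) dH', aux_mul dx dH,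
      aux_mul (by fun_prop) dK, aux_Q, aux_const, aux_coord, if_pos rfl]
    ring
  intro x hx
  have e1 : ∀ i, ε i * ε i = 1 := fun i => by rcases hε i with h | h <;> rw [h] <;> norm_num
  have hE := aux_euler hU hH hw x hx
  have h3 : lapE ε F x = lapE ε G x + Qform ε x * lapE ε H x
      + 4 * ∑ i, x i * pderiv' i H x + ∑ _i : Fin N, 2 * H x + c * lapE ε K x := by
    unfold lapE
    simp only [Finset.mul_sum, ← Finset.sum_add_distrib]
    refine Finset.sum_congr rfl fun i _ => ?_
    rw [h2 i x hx]
    linear_combination (4 * (x i * pderiv' i H x) + 2 * H x) * e1 i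
  rw [h3, hE]
  simp
  ring

theorem aux_iter {N : ℕ} {U : Set (Fin N → ℝ)} (hU : IsOpen U) (hD : DilationInvariant U)
    (ε : Fin N → ℝ)
    {f : (Fin N → ℝ) → ℝ} (hf : ContDiffOn ℝ (⊤ : ℕ∞) f U) {w : ℝ} (hw : HomogeneousOn f w U)
    (k : ℕ) : ContDiffOn ℝ (⊤ : ℕ∞) ((lapE ε)^[k] f) U ∧
      HomogeneousOn ((lapE ε)^[k] f) (w - 2 * k) U := by
  induction k with
  | zero => simpa using ⟨hf, hw⟩
  | succ k ih =>
    rw [Function.iterate_succ_apply']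
    refine ⟨aux_lap_smooth hU ε ih.1, ?_⟩
    have := aux_lap_hom hU hD ε ih.1 ih.2
    rwa [show w - 2 * ((k + 1 : ℕ) : ℝ) = w - 2 * k - 2 by push_cast; ring]

theorem aux_main {N : ℕ} {U : Set (Fin N → ℝ)} (hU : IsOpen U) (hD : DilationInvariant U)
    (ε : Fin N → ℝ) (hε : ∀ i, ε i = 1 ∨ ε i = -1) {f g h : (Fin N → ℝ) → ℝ} {w v : ℝ}
    (hg : ContDiffOn ℝ (⊤ : ℕ∞) g U) (hgv : HomogeneousOn g v U)
    (hh : ContDiffOn ℝ (⊤ : ℕ∞) h U) (hw : HomogeneousOn h w U)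
    (hfg : ∀ x ∈ U, f x - g x = Qform ε x * h x) (k : ℕ) :
    ∀ x ∈ U, (lapE ε)^[k + 1] f x = (lapE ε)^[k + 1] g x + Qform ε x * (lapE ε)^[k + 1] h x
      + (k + 1) * (4 * w + 2 * N - 4 * k) * (lapE ε)^[k] h x := by
  induction k with
  | zero =>
    intro x hx
    have := aux_step hU ε hε (F := f) (c := 0) hg hh hh hw
      (fun x hx => by linarith [hfg x hx]) x hx
    simp only [zero_add, Function.iterate_one, Function.iterate_zero, id]
    rw [this]; push_cast; ring
  | succ k ih =>
    intro x hx
    have := aux_step hU ε hε (aux_iter hU hD ε hg hgv (k + 1)).1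
      (aux_iter hU hD ε hh hw (k + 1)).1 (aux_iter hU hD ε hh hw k).1
      (aux_iter hU hD ε hh hw (k + 1)).2 ih x hx
    simp only [← Function.iterate_succ_apply' (lapE ε)] at this
    rw [this]; push_cast; ring

/-- The flat GJMS operator is well defined on the null cone: if `f` and `g` are
homogeneous of degree `m − n/2` and `f − g = Q·h` with `h` homogeneous of degree
`m − 2 − n/2`, then `Δ^m f = Δ^m g` at points of `U` where `Q` vanishes. -/
theorem lap_pow_well_defined_on_cone (n : ℕ) (hn : 1 ≤ n) (ε : Fin (n + 2) → ℝ)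
    (hε : ∀ i, ε i = 1 ∨ ε i = -1)
    (U : Set (Fin (n + 2) → ℝ)) (hU : IsOpen U) (hUdil : DilationInvariant U)
    (m : ℕ) (hm : 1 ≤ m)
    (f g h : (Fin (n + 2) → ℝ) → ℝ)
    (hf : ContDiffOn ℝ (⊤ : ℕ∞) f U) (hg : ContDiffOn ℝ (⊤ : ℕ∞) g U) (hh : ContDiffOn ℝ (⊤ : ℕ∞) h U)
    (hfhom : HomogeneousOn f ((m : ℝ) - (n : ℝ) / 2) U)
    (hghom : HomogeneousOn g ((m : ℝ) - (n : ℝ) / 2) U)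
    (hhhom : HomogeneousOn h ((m : ℝ) - 2 - (n : ℝ) / 2) U)
    (hfg : ∀ x ∈ U, f x - g x = Qform ε x * h x) :
    ∀ x ∈ U, Qform ε x = 0 → (lapE ε)^[m] f x = (lapE ε)^[m] g x := by
  intro x hx hQ
  obtain ⟨k, rfl⟩ : ∃ k, m = k + 1 := ⟨m - 1, by omega⟩
  rw [aux_main hU hUdil ε hε hg hghom hh hhhom hfg k x hx, hQ]
  push_cast
  ring
end
end

section
/- Let w ∈ ℝ be such that w + n/2 is not a positive integer, and let T be a smooth function on a dilation-invariant open set U ⊆ ℝ^N which is homogeneous of degree w. Then for every integer ℓ ≥ 0 there exist smooth functions S, g, h on U such that S is homogeneous of degree w, T = S + Q·h on U, and ΔS = Q^{ℓ}·g on U. (This is the flat scalar case of the remark following the paper's harmonic-extension proposition: for non-resonant weights the harmonic extension exists to all orders in Q.) -/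
noncomputable section

open scoped BigOperators

section Helpers
variable {N : ℕ} {U : Set (Fin N → ℝ)}

lemma hx_diffAt (hU : IsOpen U) {f : (Fin N → ℝ) → ℝ} (hf : ContDiffOn ℝ (⊤ : ℕ∞) f U)
    {x : Fin N → ℝ} (hx : x ∈ U) : DifferentiableAt ℝ f x :=
  (hf.differentiableOn (by simp)).differentiableAt (hU.mem_nhds hx)

lemma hx_smooth (hU : IsOpen U) {f : (Fin N → ℝ) → ℝ} (hf : ContDiffOn ℝ (⊤ : ℕ∞) f U)
    (i : Fin N) : ContDiffOn ℝ (⊤ : ℕ∞) (pderiv' i f) U := by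
  have h1 : ContDiffOn ℝ (⊤ : ℕ∞) (fderiv ℝ f) U :=
    hf.fderiv_of_isOpen hU (by simp)
  exact h1.clm_apply contDiffOn_const

lemma hx_lap_smooth (hU : IsOpen U) (ε : Fin N → ℝ) {f : (Fin N → ℝ) → ℝ}
    (hf : ContDiffOn ℝ (⊤ : ℕ∞) f U) : ContDiffOn ℝ (⊤ : ℕ∞) (lapE ε f) U := by
  unfold lapE
  exact ContDiffOn.sum fun i _ => contDiffOn_const.mul (hx_smooth hU (hx_smooth hU hf i) i)

lemma hx_congr (hU : IsOpen U) {f g : (Fin N → ℝ) → ℝ} (h : ∀ x ∈ U, f x = g x) (i : Fin N) :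
    ∀ x ∈ U, pderiv' i f x = pderiv' i g x := by
  intro x hx
  have : f =ᶠ[nhds x] g := Filter.eventuallyEq_of_mem (hU.mem_nhds hx) h
  simp only [pderiv', this.fderiv_eq]

lemma hx_Q_smooth (ε : Fin N → ℝ) : ContDiff ℝ (⊤ : ℕ∞) (Qform ε) := by
  unfold Qform
  fun_prop

lemma hx_mul (hU : IsOpen U) {f g : (Fin N → ℝ) → ℝ} (hf : ContDiffOn ℝ (⊤ : ℕ∞) f U)
    (hg : ContDiffOn ℝ (⊤ : ℕ∞) g U) (i : Fin N) :
    ∀ x ∈ U, pderiv' i (fun y => f y * g y) x = pderiv' i f x * g x + f x * pderiv' i g x := by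
  intro x hx
  simp only [pderiv', fderiv_fun_mul (hx_diffAt hU hf hx) (hx_diffAt hU hg hx)]
  simp
  ring

lemma hx_add (hU : IsOpen U) {f g : (Fin N → ℝ) → ℝ} (hf : ContDiffOn ℝ (⊤ : ℕ∞) f U)
    (hg : ContDiffOn ℝ (⊤ : ℕ∞) g U) (i : Fin N) :
    ∀ x ∈ U, pderiv' i (fun y => f y + g y) x = pderiv' i f x + pderiv' i g x := by
  intro x hx
  simp only [pderiv', fderiv_fun_add (hx_diffAt hU hf hx) (hx_diffAt hU hg hx)]
  simp

lemma hx_cmul (hU : IsOpen U) {f : (Fin N → ℝ) → ℝ} (hf : ContDiffOn ℝ (⊤ : ℕ∞) f U)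
    (c : ℝ) (i : Fin N) :
    ∀ x ∈ U, pderiv' i (fun y => c * f y) x = c * pderiv' i f x := by
  intro x hx
  simp only [pderiv', fderiv_const_mul (hx_diffAt hU hf hx)]
  simp

lemma hx_coord (i : Fin N) (x : Fin N → ℝ) :
    pderiv' i (fun y => y i) x = 1 := by
  have := (hasFDerivAt_apply (𝕜 := ℝ) i x).fderiv
  simp only [pderiv']
  rw [this]
  simp

lemma hx_Q (ε : Fin N → ℝ) (i : Fin N) (x : Fin N → ℝ) :
    pderiv' i (Qform ε) x = 2 * ε i * x i := by
  have h : HasFDerivAt (Qform ε)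
      (∑ j, ε j • ((2 * x j) • (ContinuousLinearMap.proj j : (Fin N → ℝ) →L[ℝ] ℝ))) x := by
    unfold Qform
    refine HasFDerivAt.fun_sum fun j _ => ?_
    have := ((hasFDerivAt_apply (𝕜 := ℝ) j x).pow 2).const_mul (ε j)
    simpa using this
  simp only [pderiv', h.fderiv]
  simp [Pi.single_apply]
  ring

lemma hx_lap_add (hU : IsOpen U) (ε : Fin N → ℝ) {f g : (Fin N → ℝ) → ℝ}
    (hf : ContDiffOn ℝ (⊤ : ℕ∞) f U) (hg : ContDiffOn ℝ (⊤ : ℕ∞) g U) (c : ℝ) :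
    ∀ x ∈ U, lapE ε (fun y => f y + c * g y) x = lapE ε f x + c * lapE ε g x := by
  intro x hx
  have hcg : ContDiffOn ℝ (⊤ : ℕ∞) (fun y => c * g y) U := contDiffOn_const.mul hg
  simp only [lapE, Finset.mul_sum, ← Finset.sum_add_distrib]
  refine Finset.sum_congr rfl fun i _ => ?_
  have h1 : ∀ y ∈ U, pderiv' i (fun y => f y + c * g y) y
      = pderiv' i f y + c * pderiv' i g y := by
    intro y hy
    rw [hx_add hU hf hcg i y hy, hx_cmul hU hg c i y hy]
  rw [hx_congr hU h1 i x hx, hx_add hU (hx_smooth hU hf i)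
    (contDiffOn_const.mul (hx_smooth hU hg i)) i x hx, hx_cmul hU (hx_smooth hU hg i) c i x hx]
  ring

lemma hx_lap_Q (hU : IsOpen U) (ε : Fin N → ℝ) (hε : ∀ i, ε i = 1 ∨ ε i = -1)
    {f : (Fin N → ℝ) → ℝ} (hf : ContDiffOn ℝ (⊤ : ℕ∞) f U) :
    ∀ x ∈ U, lapE ε (fun y => Qform ε y * f y) x
      = Qform ε x * lapE ε f x + 2 * N * f x + 4 * eulerOp f x := by
  intro x hx
  have hN : 2 * (N : ℝ) * f x = ∑ i : Fin N, 2 * f x := by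
    simp
    ring
  rw [hN]
  simp only [lapE, eulerOp, Finset.mul_sum, ← Finset.sum_add_distrib]
  refine Finset.sum_congr rfl fun i _ => ?_
  have hQ := (hx_Q_smooth ε).contDiffOn (s := U)
  have hxi : ContDiffOn ℝ (⊤ : ℕ∞) (fun y : Fin N → ℝ => y i) U := by fun_prop
  have hdf := hx_smooth hU hf i
  have h1 : ∀ y ∈ U, pderiv' i (fun y => Qform ε y * f y) y
      = 2 * ε i * (y i * f y) + Qform ε y * pderiv' i f y := by
    intro y hy
    rw [hx_mul hU hQ hf i y hy, hx_Q]
    ring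
  rw [hx_congr hU h1 i x hx, hx_add hU (contDiffOn_const.mul (hxi.mul hf)) (hQ.mul hdf) i x hx,
    hx_cmul hU (hxi.mul hf) _ i x hx, hx_mul hU hxi hf i x hx, hx_mul hU hQ hdf i x hx, hx_Q,
    hx_coord]
  have he : ε i * ε i = 1 := by rcases hε i with h | h <;> rw [h] <;> norm_num
  linear_combination (2 * f x + 4 * x i * pderiv' i f x) * he

lemma hx_hom_pderiv (hU : IsOpen U) (hd : DilationInvariant U) {f : (Fin N → ℝ) → ℝ} {w : ℝ}
    (hf : ContDiffOn ℝ (⊤ : ℕ∞) f U) (hh : HomogeneousOn f w U) (i : Fin N) :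
    HomogeneousOn (pderiv' i f) (w - 1) U := by
  intro x hx t ht
  have h1 : HasFDerivAt (fun y : Fin N → ℝ => f (t • y))
      ((fderiv ℝ f (t • x)).comp (t • ContinuousLinearMap.id ℝ (Fin N → ℝ))) x :=
    HasFDerivAt.comp x (hx_diffAt hU hf (hd x hx t ht)).hasFDerivAt
      ((hasFDerivAt_id x).const_smul t)
  have h2 : HasFDerivAt (fun y : Fin N → ℝ => t ^ w * f y) (t ^ w • fderiv ℝ f x) x :=
    (hx_diffAt hU hf hx).hasFDerivAt.const_mul _
  have h3 : (fun y : Fin N → ℝ => f (t • y)) =ᶠ[nhds x] (fun y => t ^ w * f y) :=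
    Filter.eventuallyEq_of_mem (hU.mem_nhds hx) fun y hy => hh y hy t ht
  have h4 := congrArg (fun L => L (Pi.single i 1)) (h1.unique (h2.congr_of_eventuallyEq h3))
  simp at h4
  simp only [pderiv']
  rw [Real.rpow_sub_one ht.ne']
  field_simp
  linarith

lemma hx_hom_lap (hU : IsOpen U) (hd : DilationInvariant U) (ε : Fin N → ℝ)
    {f : (Fin N → ℝ) → ℝ} {w : ℝ}
    (hf : ContDiffOn ℝ (⊤ : ℕ∞) f U) (hh : HomogeneousOn f w U) :
    HomogeneousOn (lapE ε f) (w - 2) U := by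
  intro x hx t ht
  simp only [lapE, Finset.mul_sum]
  refine Finset.sum_congr rfl fun i _ => ?_
  rw [hx_hom_pderiv hU hd (hx_smooth hU hf i) (hx_hom_pderiv hU hd hf hh i) i x hx t ht,
    show w - 1 - 1 = w - 2 by ring]
  ring

lemma hx_euler (hU : IsOpen U) {f : (Fin N → ℝ) → ℝ} {w : ℝ}
    (hf : ContDiffOn ℝ (⊤ : ℕ∞) f U) (hh : HomogeneousOn f w U) :
    ∀ x ∈ U, eulerOp f x = w * f x := by
  intro x hx
  have h0 : HasDerivAt (fun t : ℝ => t • x) x 1 := by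
    simpa using (hasDerivAt_id (1 : ℝ)).smul_const x
  have hfd : HasFDerivAt f (fderiv ℝ f x) ((1 : ℝ) • x) := by
    rw [one_smul]
    exact (hx_diffAt hU hf hx).hasFDerivAt
  have h1 : HasDerivAt (fun t : ℝ => f (t • x)) (fderiv ℝ f x x) 1 :=
    hfd.comp_hasDerivAt (1 : ℝ) h0
  have h2 : HasDerivAt (fun t : ℝ => t ^ w * f x) (w * f x) 1 := by
    simpa using (Real.hasDerivAt_rpow_const (x := 1) (p := w) (Or.inl one_ne_zero)).mul_const (f x)
  have h3 : (fun t : ℝ => f (t • x)) =ᶠ[nhds 1] (fun t : ℝ => t ^ w * f x) :=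
    Filter.eventuallyEq_of_mem (Ioi_mem_nhds one_pos) fun t ht => hh x hx t ht
  rw [← h1.unique (h2.congr_of_eventuallyEq h3)]
  have hx' : x = ∑ i, x i • (Pi.single i 1 : Fin N → ℝ) := by
    funext j
    simp [Finset.sum_apply, Pi.single_apply]
  have h5 := congrArg (fderiv ℝ f x) hx'
  rw [map_sum] at h5
  rw [h5]
  simp [eulerOp, pderiv']

lemma hx_hom_Q (ε : Fin N → ℝ) (k : ℕ) {f : (Fin N → ℝ) → ℝ} {v : ℝ} (hh : HomogeneousOn f v U) :
    HomogeneousOn (fun y => Qform ε y ^ k * f y) (v + 2 * k) U := by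
  intro x hx t ht
  have hQ : Qform ε (t • x) = t ^ 2 * Qform ε x := by
    simp only [Qform, Finset.mul_sum, Pi.smul_apply, smul_eq_mul]
    exact Finset.sum_congr rfl fun i _ => by ring
  have ht2 : t ^ (v + 2 * (k : ℝ)) = t ^ v * (t ^ 2) ^ k := by
    rw [Real.rpow_add ht, ← pow_mul, ← Real.rpow_natCast t (2 * k)]
    push_cast
    rfl
  simp only [hh x hx t ht, hQ, ht2]
  ring

lemma hx_lap_Qpow (hU : IsOpen U) (ε : Fin N → ℝ) (hε : ∀ i, ε i = 1 ∨ ε i = -1)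
    {f : (Fin N → ℝ) → ℝ} (hf : ContDiffOn ℝ (⊤ : ℕ∞) f U) {v : ℝ} (hh : HomogeneousOn f v U)
    (k : ℕ) : ∀ x ∈ U, lapE ε (fun y => Qform ε y ^ (k + 1) * f y) x
      = Qform ε x ^ (k + 1) * lapE ε f x
        + 2 * (k + 1) * (N + 2 * k + 2 * v) * (Qform ε x ^ k * f x) := by
  have key : ∀ k : ℕ, ∀ x ∈ U, lapE ε (fun y => Qform ε y ^ (k + 1) * f y) x
      = Qform ε x * lapE ε (fun y => Qform ε y ^ k * f y) x
        + (2 * N + 4 * (v + 2 * k)) * (Qform ε x ^ k * f x) := by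
    intro k x hx
    have hs : ContDiffOn ℝ (⊤ : ℕ∞) (fun y => Qform ε y ^ k * f y) U :=
      ((hx_Q_smooth ε).contDiffOn.pow k).mul hf
    have he : (fun y => Qform ε y ^ (k + 1) * f y)
        = fun y => Qform ε y * (Qform ε y ^ k * f y) := by
      funext y
      ring
    rw [he, hx_lap_Q hU ε hε hs x hx, hx_euler hU hs (hx_hom_Q ε k hh) x hx]
    ring
  induction k with
  | zero =>
    intro x hx
    rw [key 0 x hx]
    simp only [pow_zero, one_mul, zero_add, pow_one, Nat.cast_zero]
    ring
  | succ k ih =>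
    intro x hx
    rw [key (k + 1) x hx, ih x hx]
    push_cast
    ring

end Helpers

/-- Flat scalar harmonic extension to all orders for non-resonant weights: if
`w + n/2` is not a positive integer, then every `T` homogeneous of degree `w` can be
modified by an `O(Q)` term so that its Laplacian is `O(Q^ℓ)`, for every `ℓ ≥ 0`. -/
theorem harmonic_extension_all_orders (n : ℕ) (hn : 1 ≤ n) (ε : Fin (n + 2) → ℝ)
    (hε : ∀ i, ε i = 1 ∨ ε i = -1)
    (U : Set (Fin (n + 2) → ℝ)) (hU : IsOpen U) (hUdil : DilationInvariant U)
    (w : ℝ) (hw : ∀ k : ℕ, 0 < k → w + (n : ℝ) / 2 ≠ (k : ℝ))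
    (T : (Fin (n + 2) → ℝ) → ℝ) (hT : ContDiffOn ℝ (⊤ : ℕ∞) T U)
    (hThom : HomogeneousOn T w U) :
    ∀ ℓ : ℕ,
      ∃ S g h : (Fin (n + 2) → ℝ) → ℝ,
        ContDiffOn ℝ (⊤ : ℕ∞) S U ∧ ContDiffOn ℝ (⊤ : ℕ∞) g U ∧ ContDiffOn ℝ (⊤ : ℕ∞) h U ∧
        HomogeneousOn S w U ∧
        (∀ x ∈ U, T x = S x + Qform ε x * h x) ∧
        (∀ x ∈ U, lapE ε S x = (Qform ε x) ^ ℓ * g x) := by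
  intro ℓ
  suffices H : ∃ S g h : (Fin (n + 2) → ℝ) → ℝ,
      ContDiffOn ℝ (⊤ : ℕ∞) S U ∧ ContDiffOn ℝ (⊤ : ℕ∞) g U ∧ ContDiffOn ℝ (⊤ : ℕ∞) h U ∧
      HomogeneousOn S w U ∧ HomogeneousOn g (w - 2 - 2 * ℓ) U ∧
      (∀ x ∈ U, T x = S x + Qform ε x * h x) ∧
      (∀ x ∈ U, lapE ε S x = (Qform ε x) ^ ℓ * g x) by
    obtain ⟨S, g, h, h1, h2, h3, h4, -, h5, h6⟩ := H
    exact ⟨S, g, h, h1, h2, h3, h4, h5, h6⟩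
  induction ℓ with
  | zero =>
    refine ⟨T, lapE ε T, fun _ => 0, hT, hx_lap_smooth hU ε hT, contDiffOn_const, hThom, ?_,
      by simp, by simp⟩
    simpa using hx_hom_lap hU hUdil ε hT hThom
  | succ ℓ ih =>
    obtain ⟨S, g, h, hS, hg, hh, hSh, hgh, h5, h6⟩ := ih
    have hQ := (hx_Q_smooth ε).contDiffOn (s := U)
    have hne : w + (n : ℝ) / 2 - (ℓ + 1) ≠ 0 := by
      have := hw (ℓ + 1) (Nat.succ_pos _)
      push_cast at this
      exact sub_ne_zero.mpr this
    have hl : (ℓ : ℝ) + 1 ≠ 0 := by positivity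
    obtain ⟨c, hc⟩ : ∃ c : ℝ, c * (4 * ((ℓ : ℝ) + 1) * (w + (n : ℝ) / 2 - (ℓ + 1))) = -1 :=
      ⟨-(4 * ((ℓ : ℝ) + 1) * (w + (n : ℝ) / 2 - (ℓ + 1)))⁻¹, by
        rw [neg_mul, inv_mul_cancel₀ (mul_ne_zero (mul_ne_zero four_ne_zero hl) hne)]⟩
    have hP : ContDiffOn ℝ (⊤ : ℕ∞) (fun y => Qform ε y ^ (ℓ + 1) * g y) U := (hQ.pow _).mul hg
    refine ⟨fun y => S y + c * (Qform ε y ^ (ℓ + 1) * g y), fun y => c * lapE ε g y,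
      fun y => h y - c * (Qform ε y ^ ℓ * g y), hS.add (contDiffOn_const.mul hP),
      contDiffOn_const.mul (hx_lap_smooth hU ε hg),
      hh.sub (contDiffOn_const.mul ((hQ.pow _).mul hg)), ?_, ?_, ?_, ?_⟩
    · intro x hx t ht
      have := hx_hom_Q ε (ℓ + 1) hgh x hx t ht
      have e : w - 2 - 2 * (ℓ : ℝ) + 2 * ((ℓ + 1 : ℕ) : ℝ) = w := by
        push_cast
        ring
      rw [e] at this
      simp only at this ⊢
      rw [this, hSh x hx t ht]
      ring
    · intro x hx t ht
      have := hx_hom_lap hU hUdil ε hg hgh x hx t ht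
      have e : w - 2 - 2 * (ℓ : ℝ) - 2 = w - 2 - 2 * ((ℓ + 1 : ℕ) : ℝ) := by
        push_cast
        ring
      rw [e] at this
      simp only
      rw [this]
      ring
    · intro x hx
      rw [h5 x hx]
      ring
    · intro x hx
      rw [hx_lap_add hU ε hS hP c x hx, hx_lap_Qpow hU ε hε hg hgh ℓ x hx, h6 x hx]
      push_cast
      linear_combination (Qform ε x ^ ℓ * g x) * hc
end
end

section
/- Let k ≥ 1 be an integer and let V be a smooth function on a dilation-invariant open set U ⊆ ℝ^N, homogeneous of degree k − n/2. Then for all indices i₁, …, i_{k−1} ∈ {1, …, N} (not symmetrized or skewed in any way), Δ( D_{i₁}( D_{i₂}( ⋯ (D_{i_{k−1}} V) ⋯ ))) = (−1)^{k−1} · (ε_{i₁} x_{i₁}) ⋯ (ε_{i_{k−1}} x_{i_{k−1}}) · Δ^{k} V on U. (This is the conformally flat, scalar case of the paper's Proposition (−1)^{k−1}X_{A₁}⋯X_{A_{k−1}}Δ̃^{k}V = Δ̃ D̃_{A₁}⋯D̃_{A_{k−1}}V + curvature terms + O(Q): in the flat model the identity is exact with no remainder.) -/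
noncomputable section

open scoped BigOperators

/-- The `i`-th component of the flat tractor-D operator:
`Dᵢ f = ∂ᵢ((n + 2E − 2) f) − εᵢ xᵢ Δf`. -/
def Dop {N : ℕ} (n : ℕ) (ε : Fin N → ℝ) (i : Fin N) (f : (Fin N → ℝ) → ℝ) :
    (Fin N → ℝ) → ℝ :=
  fun x => pderiv' i (fun y => (n : ℝ) * f y + 2 * eulerOp f y - 2 * f y) x
    - ε i * x i * lapE ε f x

/-- Composition of tractor-D operators along a list of indices:
the head of the list is the outermost (last applied) operator. -/
def Dcomp {N : ℕ} (n : ℕ) (ε : Fin N → ℝ) : List (Fin N) → ((Fin N → ℝ) → ℝ) → ((Fin N → ℝ) → ℝ)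
  | [], f => f
  | i :: l, f => Dop n ε i (Dcomp n ε l f)

section Helpers

variable {N : ℕ} {U : Set (Fin N → ℝ)} {f g : (Fin N → ℝ) → ℝ}

theorem hDiffAt (hU : IsOpen U) (hf : ContDiffOn ℝ (⊤ : ℕ∞) f U) {x : Fin N → ℝ} (hx : x ∈ U) :
    DifferentiableAt ℝ f x :=
  ((hf.contDiffAt (hU.mem_nhds hx)).differentiableAt (by simp))

theorem pd_smooth (hU : IsOpen U) (hf : ContDiffOn ℝ (⊤ : ℕ∞) f U) (i : Fin N) :
    ContDiffOn ℝ (⊤ : ℕ∞) (pderiv' i f) U := by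
  have h := hf.fderiv_of_isOpen (m := (⊤ : ℕ∞)) hU (by simp)
  exact h.clm_apply contDiffOn_const

theorem pd_congr (hU : IsOpen U) (h : Set.EqOn f g U) (i : Fin N) :
    Set.EqOn (pderiv' i f) (pderiv' i g) U := by
  intro x hx
  unfold pderiv'
  rw [Filter.EventuallyEq.fderiv_eq (h.eventuallyEq_of_mem (hU.mem_nhds hx))]

theorem lap_congr (hU : IsOpen U) (ε : Fin N → ℝ) (h : Set.EqOn f g U) :
    Set.EqOn (lapE ε f) (lapE ε g) U := by
  intro x hx
  unfold lapE
  refine Finset.sum_congr rfl fun i _ => ?_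
  rw [pd_congr hU (pd_congr hU h i) i hx]

theorem lap_smooth (hU : IsOpen U) (ε : Fin N → ℝ) (hf : ContDiffOn ℝ (⊤ : ℕ∞) f U) :
    ContDiffOn ℝ (⊤ : ℕ∞) (lapE ε f) U := by
  unfold lapE
  exact ContDiffOn.sum fun i _ => contDiffOn_const.mul (pd_smooth hU (pd_smooth hU hf i) i)

theorem lap_iter_congr (hU : IsOpen U) (ε : Fin N → ℝ) (j : ℕ) (h : Set.EqOn f g U) :
    Set.EqOn ((lapE ε)^[j] f) ((lapE ε)^[j] g) U := by
  induction j with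
  | zero => exact h
  | succ j ih =>
    rw [Function.iterate_succ_apply', Function.iterate_succ_apply']
    exact lap_congr hU ε ih

theorem lap_iter_smooth (hU : IsOpen U) (ε : Fin N → ℝ) (hf : ContDiffOn ℝ (⊤ : ℕ∞) f U) (j : ℕ) :
    ContDiffOn ℝ (⊤ : ℕ∞) ((lapE ε)^[j] f) U := by
  induction j with
  | zero => exact hf
  | succ j ih =>
    rw [Function.iterate_succ_apply']
    exact lap_smooth hU ε ih

theorem pd_comm (hU : IsOpen U) (hf : ContDiffOn ℝ (⊤ : ℕ∞) f U) (i j : Fin N) :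
    Set.EqOn (pderiv' i (pderiv' j f)) (pderiv' j (pderiv' i f)) U := by
  intro x hx
  have hs : IsSymmSndFDerivAt ℝ f x :=
    (hf.contDiffAt (hU.mem_nhds hx)).isSymmSndFDerivAt (by simp; exact WithTop.coe_le_coe.2 le_top)
  have hd : DifferentiableAt ℝ (fderiv ℝ f) x :=
    ((hf.fderiv_of_isOpen (m := (⊤ : ℕ∞)) hU (by simp)).contDiffAt
      (hU.mem_nhds hx)).differentiableAt (by simp)
  have key : ∀ a b : Fin N, pderiv' a (pderiv' b f) x
      = fderiv ℝ (fderiv ℝ f) x (Pi.single a 1) (Pi.single b 1) := by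
    intro a b
    unfold pderiv'
    rw [fderiv_clm_apply hd (by fun_prop)]
    simp
  rw [key, key]
  exact hs _ _

theorem pd_lin (hU : IsOpen U) (hf : ContDiffOn ℝ (⊤ : ℕ∞) f U) (hg : ContDiffOn ℝ (⊤ : ℕ∞) g U)
    (c d : ℝ) (i j : Fin N) {x : Fin N → ℝ} (hx : x ∈ U) :
    pderiv' j (fun y => c * f y - d * y i * g y) x
      = c * pderiv' j f x - d * (if j = i then g x else 0) - d * x i * pderiv' j g x := by
  have hf' := (hDiffAt hU hf hx).hasFDerivAt
  have hg' := (hDiffAt hU hg hx).hasFDerivAt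
  have hp : HasFDerivAt (fun y : Fin N → ℝ => y i) (ContinuousLinearMap.proj (R := ℝ) i) x :=
    hasFDerivAt_apply i x
  have h := (hf'.const_mul c).sub ((hp.const_mul d).mul hg')
  have h2 : fderiv ℝ (fun y => c * f y - d * y i * g y) x = _ := h.fderiv
  unfold pderiv'
  rw [h2]
  by_cases hji : j = i
  · subst hji
    simp
    ring
  · simp [hji, Pi.single_apply, Ne.symm hji, eq_comm]

theorem pd_lap (hU : IsOpen U) (ε : Fin N → ℝ) (hf : ContDiffOn ℝ (⊤ : ℕ∞) f U) (i : Fin N) :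
    Set.EqOn (lapE ε (pderiv' i f)) (pderiv' i (lapE ε f)) U := by
  intro x hx
  have h : HasFDerivAt (lapE ε f)
      (∑ j, ε j • fderiv ℝ (pderiv' j (pderiv' j f)) x) x := by
    unfold lapE
    exact HasFDerivAt.fun_sum fun j _ =>
      ((hDiffAt hU (pd_smooth hU (pd_smooth hU hf j) j) hx).hasFDerivAt).const_mul (ε j)
  have h2 : pderiv' i (lapE ε f) x = ∑ j, ε j * pderiv' i (pderiv' j (pderiv' j f)) x := by
    show fderiv ℝ (lapE ε f) x (Pi.single i 1) = _
    rw [h.fderiv]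
    simp [pderiv']
  rw [h2]
  unfold lapE
  refine Finset.sum_congr rfl fun j _ => ?_
  rw [pd_comm hU (pd_smooth hU hf j) i j hx, pd_congr hU (pd_comm hU hf j i) j hx]

theorem lap_step (hU : IsOpen U) (ε : Fin N → ℝ) (hε : ∀ i, ε i = 1 ∨ ε i = -1)
    (hf : ContDiffOn ℝ (⊤ : ℕ∞) f U) (c : ℝ) (i : Fin N) :
    Set.EqOn (lapE ε (fun y => c * pderiv' i f y - ε i * y i * lapE ε f y))
      (fun y => (c - 2) * pderiv' i (lapE ε f) y - ε i * y i * lapE ε (lapE ε f) y) U := by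
  intro x hx
  have hL := lap_smooth hU ε hf
  have hP := pd_smooth hU hf i
  have h2 : ∀ j, pderiv' j (pderiv' j
      (fun y => c * pderiv' i f y - ε i * y i * lapE ε f y)) x
      = c * pderiv' j (pderiv' j (pderiv' i f)) x
        - 2 * ε i * (if j = i then pderiv' j (lapE ε f) x else 0)
        - ε i * x i * pderiv' j (pderiv' j (lapE ε f)) x := by
    intro j
    have e1 : Set.EqOn (pderiv' j (fun y => c * pderiv' i f y - ε i * y i * lapE ε f y))
        (fun y => 1 * (c * pderiv' j (pderiv' i f) y - ε i * (if j = i then lapE ε f y else 0))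
          - ε i * y i * pderiv' j (lapE ε f) y) U := by
      intro y hy
      rw [pd_lin hU hP hL c (ε i) i j hy]
      simp
    have hPj := pd_smooth hU hP j
    have hLj := pd_smooth hU hL j
    rw [pd_congr hU e1 j hx]
    by_cases hji : j = i
    · subst hji
      simp only [if_true]
      rw [pd_lin hU ((contDiffOn_const.mul hPj).sub (contDiffOn_const.mul hL)) hLj 1 _ _ _ hx]
      have h3 : pderiv' j (fun y => c * pderiv' j (pderiv' j f) y - ε j * lapE ε f y) x
          = c * pderiv' j (pderiv' j (pderiv' j f)) x - ε j * pderiv' j (lapE ε f) x := by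
        have := ((hDiffAt hU hPj hx).hasFDerivAt.const_mul c).sub
          ((hDiffAt hU hL hx).hasFDerivAt.const_mul (ε j))
        have h4 : fderiv ℝ (fun y => c * pderiv' j (pderiv' j f) y - ε j * lapE ε f y) x = _ :=
          this.fderiv
        show fderiv ℝ _ x _ = _
        rw [h4]
        simp [pderiv']
      rw [h3]
      simp only [if_true]
      ring
    · simp only [hji, if_false, mul_zero, sub_zero, one_mul]
      rw [pd_lin hU hPj hLj c _ _ _ hx]
      simp [hji]
  have hsq : ε i * ε i = 1 := by rcases hε i with h | h <;> simp [h]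
  have e3 := pd_lap hU ε hf i hx
  show ∑ j, ε j * _ = _
  simp only [h2]
  have : ∀ j, ε j * (c * pderiv' j (pderiv' j (pderiv' i f)) x
        - 2 * ε i * (if j = i then pderiv' j (lapE ε f) x else 0)
        - ε i * x i * pderiv' j (pderiv' j (lapE ε f)) x)
      = c * (ε j * pderiv' j (pderiv' j (pderiv' i f)) x)
        - (if j = i then 2 * pderiv' i (lapE ε f) x else 0)
        - ε i * x i * (ε j * pderiv' j (pderiv' j (lapE ε f)) x) := by
    intro j
    by_cases hji : j = i
    · subst hji
      simp only [if_true]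
      linear_combination (-2 * pderiv' j (lapE ε f) x) * hsq
    · simp only [hji, if_false]
      ring
  simp only [this, Finset.sum_sub_distrib, ← Finset.mul_sum]
  change c * lapE ε (pderiv' i f) x - _ - ε i * x i * lapE ε (lapE ε f) x = _
  rw [e3]
  simp
  ring

theorem lap_iter_step (hU : IsOpen U) (ε : Fin N → ℝ) (hε : ∀ i, ε i = 1 ∨ ε i = -1)
    (hf : ContDiffOn ℝ (⊤ : ℕ∞) f U) (c : ℝ) (i : Fin N) (j : ℕ) :
    Set.EqOn ((lapE ε)^[j] (fun y => c * pderiv' i f y - ε i * y i * lapE ε f y))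
      (fun y => (c - 2 * j) * pderiv' i ((lapE ε)^[j] f) y
        - ε i * y i * (lapE ε)^[j + 1] f y) U := by
  induction j with
  | zero => intro x _; simp
  | succ j ih =>
    intro x hx
    rw [Function.iterate_succ_apply' (lapE ε) j, lap_congr hU ε ih hx]
    simp only [Function.iterate_succ_apply' (lapE ε)]
    rw [lap_step hU ε hε (lap_iter_smooth hU ε hf j) _ i hx]
    push_cast
    ring

theorem pd_hom (hU : IsOpen U) (hd : DilationInvariant U) (hf : ContDiffOn ℝ (⊤ : ℕ∞) f U)
    {w : ℝ} (hw : HomogeneousOn f w U) (i : Fin N) :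
    HomogeneousOn (pderiv' i f) (w - 1) U := by
  intro x hx t ht
  have h1 : HasFDerivAt (fun y : Fin N → ℝ => t • y) (t • ContinuousLinearMap.id ℝ _) x :=
    (hasFDerivAt_id x).const_smul t
  have h2 := (hDiffAt hU hf (hd x hx t ht)).hasFDerivAt.comp x h1
  have h3 := (hDiffAt hU hf hx).hasFDerivAt.const_mul (t ^ w)
  have h4 : (f ∘ fun y : Fin N → ℝ => t • y) =ᶠ[nhds x] (fun y => t ^ w * f y) := by
    filter_upwards [hU.mem_nhds hx] with y hy
    exact hw y hy t ht
  have h5 := h2.unique (h3.congr_of_eventuallyEq h4)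
  have h6 := congrArg (fun L => L (Pi.single i (1 : ℝ))) h5
  simp at h6
  unfold pderiv'
  rw [Real.rpow_sub ht, Real.rpow_one]
  field_simp
  linarith

theorem lap_hom (hU : IsOpen U) (hd : DilationInvariant U) (ε : Fin N → ℝ)
    (hf : ContDiffOn ℝ (⊤ : ℕ∞) f U) {w : ℝ} (hw : HomogeneousOn f w U) :
    HomogeneousOn (lapE ε f) (w - 1 - 1) U := by
  intro x hx t ht
  unfold lapE
  rw [Finset.mul_sum]
  refine Finset.sum_congr rfl fun i _ => ?_
  rw [pd_hom hU hd (pd_smooth hU hf i) (pd_hom hU hd hf hw i) i x hx t ht]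
  ring

theorem euler_hom (hU : IsOpen U) (hf : ContDiffOn ℝ (⊤ : ℕ∞) f U)
    {w : ℝ} (hw : HomogeneousOn f w U) {x : Fin N → ℝ} (hx : x ∈ U) :
    eulerOp f x = w * f x := by
  have h1 : HasDerivAt (fun t : ℝ => t • x) ((1 : ℝ) • x) 1 := (hasDerivAt_id (1 : ℝ)).smul_const x
  have hf1 : HasFDerivAt f (fderiv ℝ f x) ((1 : ℝ) • x) := by
    rw [one_smul]; exact (hDiffAt hU hf hx).hasFDerivAt
  have h2 := hf1.comp_hasDerivAt (1 : ℝ) h1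
  have h3 : HasDerivAt (fun t : ℝ => t ^ w * f x) (w * (1 : ℝ) ^ (w - 1) * f x) 1 :=
    (Real.hasDerivAt_rpow_const (Or.inl one_ne_zero)).mul_const _
  have h4 : (f ∘ fun t : ℝ => t • x) =ᶠ[nhds 1] (fun t => t ^ w * f x) := by
    filter_upwards [lt_mem_nhds (zero_lt_one (α := ℝ))] with t ht
    exact hw x hx t ht
  have h5 := h2.unique (h3.congr_of_eventuallyEq h4)
  simp at h5
  rw [← h5]
  unfold eulerOp pderiv'
  have hsum : fderiv ℝ f x x = fderiv ℝ f x (∑ i, (x i) • Pi.single (M := fun _ => ℝ) i 1) :=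
    congrArg _ (pi_eq_sum_univ' x)
  rw [hsum, map_sum]
  refine Finset.sum_congr rfl fun i _ => ?_
  rw [map_smul, smul_eq_mul]

theorem Dop_eq (hU : IsOpen U) (n : ℕ) (ε : Fin N → ℝ)
    (hf : ContDiffOn ℝ (⊤ : ℕ∞) f U) {w : ℝ} (hw : HomogeneousOn f w U) (i : Fin N) :
    Set.EqOn (Dop n ε i f)
      (fun y => (n + 2 * w - 2) * pderiv' i f y - ε i * y i * lapE ε f y) U := by
  intro x hx
  unfold Dop
  have h : Set.EqOn (fun y => (n : ℝ) * f y + 2 * eulerOp f y - 2 * f y)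
      (fun y => (n + 2 * w - 2) * f y) U := by
    intro y hy
    simp only [euler_hom hU hf hw hy]
    ring
  rw [pd_congr hU h i hx]
  have := ((hDiffAt hU hf hx).hasFDerivAt.const_mul ((n : ℝ) + 2 * w - 2)).fderiv
  have h2 : pderiv' i (fun y => ((n : ℝ) + 2 * w - 2) * f y) x
      = (n + 2 * w - 2) * pderiv' i f x := by
    show fderiv ℝ _ x _ = _
    rw [this]
    simp [pderiv']
  rw [h2]

theorem Dop_smooth (hU : IsOpen U) (n : ℕ) (ε : Fin N → ℝ)
    (hf : ContDiffOn ℝ (⊤ : ℕ∞) f U) {w : ℝ} (hw : HomogeneousOn f w U) (i : Fin N) :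
    ContDiffOn ℝ (⊤ : ℕ∞) (Dop n ε i f) U := by
  refine ContDiffOn.congr ?_ (Dop_eq hU n ε hf hw i)
  exact (contDiffOn_const.mul (pd_smooth hU hf i)).sub
    ((contDiffOn_const.mul (contDiff_apply ℝ ℝ i).contDiffOn).mul (lap_smooth hU ε hf))

theorem Dop_hom (hU : IsOpen U) (hd : DilationInvariant U) (n : ℕ) (ε : Fin N → ℝ)
    (hf : ContDiffOn ℝ (⊤ : ℕ∞) f U) {w : ℝ} (hw : HomogeneousOn f w U) (i : Fin N) :
    HomogeneousOn (Dop n ε i f) (w - 1) U := by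
  intro x hx t ht
  rw [Dop_eq hU n ε hf hw i hx, Dop_eq hU n ε hf hw i (hd x hx t ht)]
  simp only
  rw [pd_hom hU hd hf hw i x hx t ht, lap_hom hU hd ε hf hw x hx t ht,
    Real.rpow_sub ht (w - 1), Real.rpow_one]
  simp only [Pi.smul_apply, smul_eq_mul]
  field_simp

theorem Dcomp_main (hU : IsOpen U) (hd : DilationInvariant U) (n : ℕ) (ε : Fin N → ℝ)
    (hε : ∀ i, ε i = 1 ∨ ε i = -1) (l : List (Fin N)) :
    ∀ (j : ℕ), ContDiffOn ℝ (⊤ : ℕ∞) f U →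
      HomogeneousOn f (((j + l.length : ℕ) : ℝ) - (n : ℝ) / 2) U →
      ContDiffOn ℝ (⊤ : ℕ∞) (Dcomp n ε l f) U ∧
      HomogeneousOn (Dcomp n ε l f) ((j : ℝ) - (n : ℝ) / 2) U ∧
      ∀ x ∈ U, (lapE ε)^[j] (Dcomp n ε l f) x
        = (-1 : ℝ) ^ l.length * (l.map fun i => ε i * x i).prod
          * (lapE ε)^[j + l.length] f x := by
  induction l with
  | nil =>
    intro j hf hw
    refine ⟨hf, by simpa [Dcomp] using hw, fun x hx => by simp [Dcomp]⟩
  | cons i l ih =>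
    intro j hf hw
    have e : j + (i :: l).length = (j + 1) + l.length := by simp; ring
    rw [e] at hw ⊢
    obtain ⟨h1, h2, h3⟩ := ih (j + 1) hf hw
    refine ⟨Dop_smooth hU n ε h1 h2 i, ?_, fun x hx => ?_⟩
    · have := Dop_hom hU hd n ε h1 h2 i
      have e2 : (((j + 1 : ℕ) : ℝ) - (n : ℝ) / 2 - 1) = (j : ℝ) - n / 2 := by push_cast; ring
      rw [e2] at this
      exact this
    · show (lapE ε)^[j] (Dop n ε i (Dcomp n ε l f)) x = _
      rw [lap_iter_congr hU ε j (Dop_eq hU n ε h1 h2 i) hx, lap_iter_step hU ε hε h1 _ i j hx]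
      simp only
      rw [h3 x hx]
      simp only [List.map_cons, List.prod_cons, List.length_cons, pow_succ]
      push_cast
      ring

end Helpers

/-- Flat scalar case of `(−1)^(k−1) X_{A₁}⋯X_{A_{k−1}} Δ^k V = Δ D_{A₁}⋯D_{A_{k−1}} V`
on functions homogeneous of degree `k − n/2`; in the flat model the identity is exact. -/
theorem lap_Dcomp_identity (n : ℕ) (hn : 1 ≤ n) (ε : Fin (n + 2) → ℝ)
    (hε : ∀ i, ε i = 1 ∨ ε i = -1)
    (U : Set (Fin (n + 2) → ℝ)) (hU : IsOpen U) (hUdil : DilationInvariant U)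
    (k : ℕ) (hk : 1 ≤ k)
    (V : (Fin (n + 2) → ℝ) → ℝ) (hV : ContDiffOn ℝ (⊤ : ℕ∞) V U)
    (hVhom : HomogeneousOn V ((k : ℝ) - (n : ℝ) / 2) U) :
    ∀ σ : Fin (k - 1) → Fin (n + 2), ∀ x ∈ U,
      lapE ε (Dcomp n ε (List.ofFn σ) V) x
        = (-1 : ℝ) ^ (k - 1) * (∏ j : Fin (k - 1), ε (σ j) * x (σ j))
            * (lapE ε)^[k] V x := by
  intro σ x hx
  have hlen : 1 + (List.ofFn σ).length = k := by simp; omega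
  have h := (Dcomp_main hU hUdil n ε hε (List.ofFn σ) (f := V) 1 hV (by rw [hlen]; exact hVhom)).2.2 x hx
  rw [hlen] at h
  simpa [List.map_ofFn, List.prod_ofFn] using h
end
end
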